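/- There do not exist one-variable polynomials A, B, C, D, E, F ∈ k[X] with deg B ≥ 2, deg D ≥ 2, deg E ≥ 2, and deg F ≥ 2, such that in k[x,y] one has A(x) + E(y + B(x)) = C(y) + F(x + D(y)). -/

import Mathlib

theorem natDegree_taylor_sub_taylor_le {k : Type*} [Field k] (F : Polynomial k) (u v : k) :
    (Polynomial.taylor u F - Polynomial.taylor v F).natDegree ≤ F.natDegree - 1 := by
  apply Polynomial.natDegree_le_pred
  · simpa using Polynomial.natDegree_sub_le (Polynomial.taylor u F) (Polynomial.taylor v F)
  · simp [Polynomial.coeff_sub, Polynomial.coeff_taylor_natDegree]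

theorem le_natDegree_taylor_one_sub_self {k : Type*} [Field k] [CharZero k] (E : Polynomial k)
    (hE : 0 < E.natDegree) :
    E.natDegree - 1 ≤ (Polynomial.taylor 1 E - E).natDegree := by
  apply Polynomial.le_natDegree_of_ne_zero
  obtain ⟨n, hn⟩ : ∃ n, E.natDegree = n + 1 := ⟨E.natDegree - 1, by omega⟩
  have hE0 : E ≠ 0 := Polynomial.ne_zero_of_natDegree_gt hE
  have hlead : E.coeff (n + 1) ≠ 0 := by
    rw [← hn]
    exact Polynomial.leadingCoeff_ne_zero.mpr hE0
  have hdeg : (Polynomial.hasseDeriv n E).natDegree < 2 := by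
    have := Polynomial.natDegree_hasseDeriv_le E n
    omega
  rw [hn, Nat.add_sub_cancel, Polynomial.coeff_sub, Polynomial.taylor_coeff,
    Polynomial.eval_eq_sum_range' hdeg]
  simp only [Finset.sum_range_succ, Finset.sum_range_zero, Polynomial.hasseDeriv_coeff,
    one_pow, mul_one, zero_add, Nat.choose_self, Nat.cast_one, one_mul, add_comm 1 n,
    Nat.choose_succ_self_right, add_sub_cancel_left]
  exact mul_ne_zero (Nat.cast_ne_zero.mpr n.succ_ne_zero) hlead

/-- Comparing the specializations `y = 0` and `y = 1` of `A(x) + E(y + B(x)) = c(y) + F(x + D(y))`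
bounds `deg F` from below. -/
theorem natDegree_sub_one_mul_le_of_specializations {k : Type*} [Field k] [CharZero k]
    {A B E F : Polynomial k} {c d : k → k} (hE : 0 < E.natDegree)
    (h : ∀ y, A + E.comp (Polynomial.C y + B)
      = Polynomial.C (c y) + F.comp (Polynomial.X + Polynomial.C (d y))) :
    (E.natDegree - 1) * B.natDegree ≤ F.natDegree - 1 := by
  have key : (Polynomial.taylor 1 E - E).comp B
      = (Polynomial.taylor (d 1) F - Polynomial.taylor (d 0) F)
        + Polynomial.C (c 1 - c 0) := by
    have h1 := h 1
    have h0 := h 0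
    rw [Polynomial.C_0, zero_add] at h0
    rw [Polynomial.sub_comp, Polynomial.taylor_apply, Polynomial.taylor_apply,
      Polynomial.taylor_apply, Polynomial.comp_assoc, Polynomial.C_sub, Polynomial.add_comp,
      Polynomial.X_comp, Polynomial.C_comp, add_comm B]
    linear_combination h1 - h0
  calc (E.natDegree - 1) * B.natDegree
      ≤ (Polynomial.taylor 1 E - E).natDegree * B.natDegree :=
        Nat.mul_le_mul_right _ (le_natDegree_taylor_one_sub_self E hE)
    _ = ((Polynomial.taylor 1 E - E).comp B).natDegree := Polynomial.natDegree_comp.symm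
    _ ≤ F.natDegree - 1 := by
        rw [key, Polynomial.natDegree_add_C]
        exact natDegree_taylor_sub_taylor_le F _ _

/-- There are no one-variable polynomials `A, B, Cc, D, E, F` with
`deg B, deg D, deg E, deg F ≥ 2` such that `A(x) + E(y + B(x)) = Cc(y) + F(x + D(y))`
in `k[x,y]`. -/
theorem no_bihexagon_a (k : Type) [Field k] [CharZero k] :
    ¬ ∃ A B Cc D E F : Polynomial k,
      2 ≤ B.natDegree ∧ 2 ≤ D.natDegree ∧ 2 ≤ E.natDegree ∧ 2 ≤ F.natDegree ∧
      Polynomial.aeval (MvPolynomial.X 0 : MvPolynomial (Fin 2) k) A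
        + Polynomial.aeval ((MvPolynomial.X 1 : MvPolynomial (Fin 2) k)
            + Polynomial.aeval (MvPolynomial.X 0 : MvPolynomial (Fin 2) k) B) E
      = Polynomial.aeval (MvPolynomial.X 1 : MvPolynomial (Fin 2) k) Cc
        + Polynomial.aeval ((MvPolynomial.X 0 : MvPolynomial (Fin 2) k)
            + Polynomial.aeval (MvPolynomial.X 1 : MvPolynomial (Fin 2) k) D) F := by
  rintro ⟨A, B, Cc, D, E, F, hB, hD, hE, hF, h⟩
  have hx := natDegree_sub_one_mul_le_of_specializations (A := A) (B := B) (E := E) (F := F)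
    (c := fun y => Cc.eval y) (d := fun y => D.eval y) (by omega) fun y => by
      have := congrArg (MvPolynomial.aeval ![(Polynomial.X : Polynomial k), Polynomial.C y]) h
      simpa [← Polynomial.aeval_algHom_apply, ← Polynomial.comp_eq_aeval,
        Polynomial.comp_C] using this
  have hy := natDegree_sub_one_mul_le_of_specializations (A := Cc) (B := D) (E := F) (F := E)
    (c := fun x => A.eval x) (d := fun x => B.eval x) (by omega) fun x => by
      have := congrArg (MvPolynomial.aeval ![Polynomial.C x, (Polynomial.X : Polynomial k)]) h
      simpa [← Polynomial.aeval_algHom_apply, ← Polynomial.comp_eq_aeval,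
        Polynomial.comp_C] using this.symm
  have hx' := (Nat.mul_le_mul_left (E.natDegree - 1) hB).trans hx
  have hy' := (Nat.mul_le_mul_left (F.natDegree - 1) hD).trans hy
  omega
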